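/- arXiv:1104.3487 — 2 statements merged into one kernel-verified Lean document; each statement's English description precedes it below -/
import Mathlib

section
/- The tetrahedron weight is totally antisymmetric in its vertices: for pairwise distinct i₁,i₂,i₃,i₄ ∈ {1,…,5} and any permutation σ of {1,2,3,4}, f_{i_{σ(1)} i_{σ(2)} i_{σ(3)} i_{σ(4)}} = sgn(σ) · f_{i₁ i₂ i₃ i₄}. -/
/-!  Context: a Grassmann algebra `Λ` over a field `F` of characteristic ≠ 2, with
anticommuting generators indexed by a type `ι` (for us: the (3-element) subsets
`S ⊆ Fin 5`, possibly together with extra generators `b`).  Vertex `k ∈ {1,…,5}`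
of the paper corresponds to `k - 1 : Fin 5`, so `ζ_{ij} = ζ (i-1) - ζ (j-1)`.
The Berezin integral in a generator is axiomatized by the predicate `IsBerezin`. -/

/-- The subalgebra of elements not involving the generator `e i`, i.e. the
subalgebra generated by all the other generators. -/
def notInvolving (F : Type*) [Field F] {Λ : Type*} [Ring Λ] [Algebra F Λ]
    {ι : Type*} (e : ι → Λ) (i : ι) : Subalgebra F Λ :=
  Algebra.adjoin F { x | ∃ j, j ≠ i ∧ x = e j }

/-- `B` is the Berezin integral with respect to the generator `e i`: it is `F`-linear
and, writing `x = g + h * e i` with `g`, `h` not involving `e i` (the generator moved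
to the rightmost position), one has `B x = h`.  Equivalently: `B g = 0` and
`B (h * e i) = h` for `g`, `h` not involving `e i`. -/
def IsBerezin (F : Type*) [Field F] {Λ : Type*} [Ring Λ] [Algebra F Λ]
    {ι : Type*} (e : ι → Λ) (i : ι) (B : Λ →ₗ[F] Λ) : Prop :=
  (∀ g ∈ notInvolving F e i, B g = 0) ∧
  (∀ h ∈ notInvolving F e i, B (h * e i) = h)

/-- The tetrahedron weight `f_{i₁i₂i₃i₄}` (formula (1) of the paper), where
`a S` is the Grassmann generator attached to the unoriented 2-face `S`. -/
def fw {F : Type*} [Field F] {Λ : Type*} [Ring Λ] [Algebra F Λ]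
    (ζ : Fin 5 → F) (a : Finset (Fin 5) → Λ) (i₁ i₂ i₃ i₄ : Fin 5) : Λ :=
  (ζ i₁ - ζ i₂) • (a {i₁, i₂, i₃} * a {i₁, i₂, i₄})
    - (ζ i₁ - ζ i₃) • (a {i₁, i₂, i₃} * a {i₁, i₃, i₄})
    + (ζ i₁ - ζ i₄) • (a {i₁, i₂, i₄} * a {i₁, i₃, i₄})
    + (ζ i₂ - ζ i₃) • (a {i₁, i₂, i₃} * a {i₂, i₃, i₄})
    - (ζ i₂ - ζ i₄) • (a {i₁, i₂, i₄} * a {i₂, i₃, i₄})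
    + (ζ i₃ - ζ i₄) • (a {i₁, i₃, i₄} * a {i₂, i₃, i₄})

section Antisymmetry

variable {F : Type*} [Field F] {Λ : Type*} [Ring Λ] [Algebra F Λ] (ζ : Fin 5 → F)
  {a : Finset (Fin 5) → Λ}

theorem fw_swap_first (hanti : ∀ S T, a S * a T = -(a T * a S)) (p q r s : Fin 5) :
    fw ζ a q p r s = -fw ζ a p q r s := by
  simp only [fw, Finset.insert_comm q p, hanti {q, r, s} {p, r, s}]
  module

theorem fw_swap_middle (hanti : ∀ S T, a S * a T = -(a T * a S)) (p q r s : Fin 5) :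
    fw ζ a p r q s = -fw ζ a p q r s := by
  simp only [fw, Finset.insert_comm r q, Finset.pair_comm r q, hanti {p, r, s} {p, q, s}]
  module

theorem fw_swap_last (hanti : ∀ S T, a S * a T = -(a T * a S)) (p q r s : Fin 5) :
    fw ζ a p q s r = -fw ζ a p q r s := by
  simp only [fw, Finset.pair_comm s r, hanti {p, q, s} {p, q, r}]
  module

theorem fw_comp_swap_castSucc_succ (hanti : ∀ S T, a S * a T = -(a T * a S))
    (j : Fin 4 → Fin 5) (k : Fin 3) :
    let τ := Equiv.swap k.castSucc k.succ
    fw ζ a (j (τ 0)) (j (τ 1)) (j (τ 2)) (j (τ 3)) = -fw ζ a (j 0) (j 1) (j 2) (j 3) := by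
  fin_cases k
  · exact fw_swap_first ζ hanti _ _ _ _
  · exact fw_swap_middle ζ hanti _ _ _ _
  · exact fw_swap_last ζ hanti _ _ _ _

theorem fw_comp_perm (hanti : ∀ S T, a S * a T = -(a T * a S))
    (σ : Equiv.Perm (Fin 4)) (j : Fin 4 → Fin 5) :
    fw ζ a (j (σ 0)) (j (σ 1)) (j (σ 2)) (j (σ 3)) =
      (Equiv.Perm.sign σ : ℤ) • fw ζ a (j 0) (j 1) (j 2) (j 3) := by
  have hσ : σ ∈ Submonoid.closure
      (Set.range fun k : Fin 3 ↦ Equiv.swap k.castSucc k.succ) := by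
    rw [Equiv.Perm.mclosure_swap_castSucc_succ]
    trivial
  induction hσ using Submonoid.closure_induction generalizing j with
  | mem τ hτ =>
    obtain ⟨k, rfl⟩ := hτ
    simpa [Equiv.Perm.sign_swap (Fin.castSucc_lt_succ (i := k)).ne] using
      fw_comp_swap_castSucc_succ ζ hanti j k
  | one => simp
  | mul σ τ _ _ ihσ ihτ =>
    have h := ihτ (j ∘ σ)
    simp only [Function.comp_apply, ihσ j] at h
    simp only [Equiv.Perm.mul_apply, h, map_mul, Units.val_mul, smul_smul, mul_comm]

end Antisymmetry

/-- The tetrahedron weight is totally antisymmetric in its vertices: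
for pairwise distinct `i₁, i₂, i₃, i₄` and any permutation `σ` of `{1,2,3,4}`,
`f_{i_{σ(1)} i_{σ(2)} i_{σ(3)} i_{σ(4)}} = sgn(σ) · f_{i₁ i₂ i₃ i₄}`. -/
theorem fw_antisymm
    {F : Type*} [Field F] {Λ : Type*} [Ring Λ] [Algebra F Λ]
    (hchar : (2 : F) ≠ 0)
    (ζ : Fin 5 → F)
    (a : Finset (Fin 5) → Λ)
    (hanti : ∀ S T, a S * a T = -(a T * a S))
    (hsq : ∀ S, a S * a S = 0)
    (i : Fin 4 → Fin 5) (hi : Function.Injective i)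
    (σ : Equiv.Perm (Fin 4)) :
    fw ζ a (i (σ 0)) (i (σ 1)) (i (σ 2)) (i (σ 3)) =
      (Equiv.Perm.sign σ : ℤ) • fw ζ a (i 0) (i 1) (i 2) (i 3) :=
  fw_comp_perm ζ hanti σ i
end

section
/- Assume ζ_4 ≠ ζ_5 and let λ ∈ F. Expand L = ∫ g_{1234} g_{1235} da_{123} and R = −(1/ζ_{45}) ∭ g_{1245} g_{2345} g_{1345} da_{345} da_{245} da_{145} as F-linear combinations of ordered monomials in the generators a_S (each monomial written as a product of distinct generators in a fixed order). Then the coefficients of the degree-5 monomial a_{124} a_{125} a_{134} a_{135} a_{235} in L and in R are equal. -/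
/-- `c_{i₁i₂i₃i₄} = ∏_{1 ≤ k < l ≤ 4} ζ_{i_k i_l}`. -/
def cc {F : Type*} [Field F] (ζ : Fin 5 → F) (i₁ i₂ i₃ i₄ : Fin 5) : F :=
  (ζ i₁ - ζ i₂) * (ζ i₁ - ζ i₃) * (ζ i₁ - ζ i₄) * (ζ i₂ - ζ i₃) * (ζ i₂ - ζ i₄) * (ζ i₃ - ζ i₄)

/-- The deformed weight `g_{i₁i₂i₃i₄} = f_{i₁i₂i₃i₄} + ε λ c_{i₁i₂i₃i₄}
a_{i₁i₂i₃} a_{i₁i₂i₄} a_{i₁i₃i₄} a_{i₂i₃i₄}`, with orientation sign `eps = ε_{i₁i₂i₃i₄}`. -/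
def gw {F : Type*} [Field F] {Λ : Type*} [Ring Λ] [Algebra F Λ]
    (ζ : Fin 5 → F) (a : Finset (Fin 5) → Λ) (lam eps : F) (i₁ i₂ i₃ i₄ : Fin 5) : Λ :=
  fw ζ a i₁ i₂ i₃ i₄ +
    (eps * lam * cc ζ i₁ i₂ i₃ i₄) •
      (a {i₁, i₂, i₃} * a {i₁, i₂, i₄} * a {i₁, i₃, i₄} * a {i₂, i₃, i₄})

section GrassmannWords

variable {F : Type*} [Field F] {Λ : Type*} [Ring Λ] [Algebra F Λ] {ι : Type*}

theorem mul_word_of_anticomm {a : ι → Λ} (hanti : ∀ S T, a S * a T = -(a T * a S))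
    (i : ι) (l : List ι) :
    a i * (l.map a).prod = (-1 : F) ^ l.length • ((l.map a).prod * a i) := by
  induction l with
  | nil => simp
  | cons j l ih =>
    rw [List.map_cons, List.prod_cons, ← mul_assoc, hanti i j, neg_mul, mul_assoc, ih,
      mul_smul_comm, List.length_cons, pow_succ, mul_assoc]
    module

theorem word_move_right {a : ι → Λ} (hanti : ∀ S T, a S * a T = -(a T * a S))
    (i : ι) (l₁ l₂ l₃ : List ι) :
    ((l₁ ++ i :: (l₂ ++ l₃)).map a).prod =
      (-1 : F) ^ l₂.length • ((l₁ ++ (l₂ ++ i :: l₃)).map a).prod := by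
  simp only [List.map_append, List.prod_append, List.map_cons, List.prod_cons]
  rw [← mul_assoc (a i), mul_word_of_anticomm (F := F) hanti, smul_mul_assoc, mul_smul_comm,
    mul_assoc]

theorem word_eq_zero_of_not_nodup {a : ι → Λ} (hanti : ∀ S T, a S * a T = -(a T * a S))
    (hsq : ∀ S, a S * a S = 0) {l : List ι} (hl : ¬ l.Nodup) : (l.map a).prod = 0 := by
  induction l with
  | nil => simp at hl
  | cons i l ih =>
    by_cases h : i ∈ l
    · obtain ⟨s, t, rfl⟩ := List.append_of_mem h
      have key : ∀ s : List ι, a i * ((s.map a).prod * a i) = 0 := by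
        intro s
        induction s with
        | nil => simp [hsq]
        | cons j s ihs =>
          rw [List.map_cons, List.prod_cons, mul_assoc, ← mul_assoc (a i), hanti i j, neg_mul,
            mul_assoc, ihs, mul_zero, neg_zero]
      simp only [List.map_append, List.prod_append, List.map_cons, List.prod_cons]
      rw [← mul_assoc (List.prod _), ← mul_assoc (a i), key, zero_mul]
    · rw [List.map_cons, List.prod_cons, ih fun h' => hl (List.nodup_cons.2 ⟨h, h'⟩), mul_zero]

theorem word_mem_notInvolving (a : ι → Λ) {i : ι} {l : List ι} (hi : i ∉ l) :
    (l.map a).prod ∈ notInvolving F a i := by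
  refine Subalgebra.list_prod_mem _ fun x hx => ?_
  obtain ⟨j, hj, rfl⟩ := List.mem_map.1 hx
  exact Algebra.subset_adjoin ⟨j, fun h => hi (h ▸ hj), rfl⟩

theorem IsBerezin.map_word {a : ι → Λ} {i : ι} {B : Λ →ₗ[F] Λ} (hB : IsBerezin F a i B)
    (hanti : ∀ S T, a S * a T = -(a T * a S)) {l₁ l₂ : List ι} (h₁ : i ∉ l₁) (h₂ : i ∉ l₂) :
    B ((l₁ ++ i :: l₂).map a).prod = (-1 : F) ^ l₂.length • ((l₁ ++ l₂).map a).prod := by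
  have h := word_move_right (F := F) hanti i l₁ l₂ []
  rw [List.append_nil, ← List.append_assoc, List.map_append (l₁ := l₁ ++ l₂), List.prod_append,
    List.map_singleton, List.prod_singleton] at h
  rw [h, map_smul, hB.2 _ (word_mem_notInvolving a (by simp [h₁, h₂]))]

end GrassmannWords

/-- The span of the monomials whose set of faces differs from `A`. -/
def otherMonomials (F : Type*) [Field F] {Λ : Type*} [Ring Λ] [Algebra F Λ]
    (a : Finset (Fin 5) → Λ) (A : Finset (Finset (Fin 5))) : Submodule F Λ :=
  Submodule.span F { x : Λ | ∃ l : List (Finset (Fin 5)),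
    l.Nodup ∧ (∀ S ∈ l, S.card = 3) ∧ l.toFinset ≠ A ∧ x = (l.map a).prod }

/-- The monomials occurring in the weight of the tetrahedron `i₁i₂i₃i₄`. -/
def weightWord (i₁ i₂ i₃ i₄ : Fin 5) : Fin 7 → List (Finset (Fin 5)) :=
  ![[{i₁, i₂, i₃}, {i₁, i₂, i₄}], [{i₁, i₂, i₃}, {i₁, i₃, i₄}], [{i₁, i₂, i₄}, {i₁, i₃, i₄}],
    [{i₁, i₂, i₃}, {i₂, i₃, i₄}], [{i₁, i₂, i₄}, {i₂, i₃, i₄}], [{i₁, i₃, i₄}, {i₂, i₃, i₄}],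
    [{i₁, i₂, i₃}, {i₁, i₂, i₄}, {i₁, i₃, i₄}, {i₂, i₃, i₄}]]

/-- The coefficients of the monomials `weightWord` in the weight `gw`. -/
def weightCoeff {F : Type*} [Field F] (ζ : Fin 5 → F) (lam eps : F) (i₁ i₂ i₃ i₄ : Fin 5) :
    Fin 7 → F :=
  ![ζ i₁ - ζ i₂, -(ζ i₁ - ζ i₃), ζ i₁ - ζ i₄, ζ i₂ - ζ i₃, -(ζ i₂ - ζ i₄), ζ i₃ - ζ i₄,
    eps * lam * cc ζ i₁ i₂ i₃ i₄]

section Weights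

variable {F : Type*} [Field F] {Λ : Type*} [Ring Λ] [Algebra F Λ] {a : Finset (Fin 5) → Λ}

theorem word_mem_otherMonomials (hanti : ∀ S T, a S * a T = -(a T * a S))
    (hsq : ∀ S, a S * a S = 0) {A : Finset (Finset (Fin 5))} {l : List (Finset (Fin 5))}
    (hc : ∀ S ∈ l, S.card = 3) (hA : l.Nodup → l.toFinset ≠ A) :
    (l.map a).prod ∈ otherMonomials F a A := by
  by_cases hl : l.Nodup
  · exact Submodule.subset_span ⟨l, hl, hc, hA hl, rfl⟩
  · rw [word_eq_zero_of_not_nodup hanti hsq hl]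
    exact zero_mem _

theorem IsBerezin.map_mem_otherMonomials {i : Finset (Fin 5)} {B : Λ →ₗ[F] Λ}
    (hB : IsBerezin F a i B) (hanti : ∀ S T, a S * a T = -(a T * a S))
    {A : Finset (Finset (Fin 5))} {x : Λ} (hx : x ∈ otherMonomials F a (insert i A)) :
    B x ∈ otherMonomials F a A := by
  refine Submodule.span_le (p := (otherMonomials F a A).comap B).2 ?_ hx
  rintro _ ⟨l, hl, hc, hA, rfl⟩
  by_cases h : i ∈ l
  · obtain ⟨s, t, rfl⟩ := List.append_of_mem h
    rw [List.nodup_middle, List.nodup_cons, List.mem_append, not_or] at hl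
    rw [SetLike.mem_coe, Submodule.mem_comap, hB.map_word hanti hl.1.1 hl.1.2]
    refine Submodule.smul_mem _ _ (Submodule.subset_span ⟨s ++ t, hl.2, ?_, ?_, rfl⟩)
    · intro S hS
      exact hc S (by simp only [List.mem_append, List.mem_cons] at hS ⊢; tauto)
    · rintro rfl
      exact hA (by ext; simp)
  · rw [SetLike.mem_coe, Submodule.mem_comap, hB.1 _ (word_mem_notInvolving a h)]
    exact zero_mem _

theorem gw_eq_sum (ζ : Fin 5 → F) (lam eps : F) (i₁ i₂ i₃ i₄ : Fin 5) :
    gw ζ a lam eps i₁ i₂ i₃ i₄ =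
      ∑ k, weightCoeff ζ lam eps i₁ i₂ i₃ i₄ k • ((weightWord i₁ i₂ i₃ i₄ k).map a).prod := by
  simp only [gw, fw, weightCoeff, weightWord, Fin.sum_univ_seven, Matrix.cons_val,
    List.map_cons, List.map_nil, List.prod_cons, List.prod_nil, mul_one, mul_assoc]
  module

theorem sum_sub_sum_mem_otherMonomials (hanti : ∀ S T, a S * a T = -(a T * a S))
    (hsq : ∀ S, a S * a S = 0) {A : Finset (Finset (Fin 5))} {κ : Type*} [Fintype κ]
    [DecidableEq κ] (s : Finset κ) (c : κ → F) (w : κ → List (Finset (Fin 5)))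
    (hc : ∀ k, ∀ S ∈ w k, S.card = 3)
    (hA : ∀ k ∉ s, (w k).Nodup → (w k).toFinset ≠ A) :
    ∑ k, c k • ((w k).map a).prod - ∑ k ∈ s, c k • ((w k).map a).prod ∈ otherMonomials F a A := by
  rw [← Finset.sum_compl_add_sum s, add_sub_cancel_right]
  exact Submodule.sum_mem _ fun k hk => Submodule.smul_mem _ _
    (word_mem_otherMonomials hanti hsq (hc k) (hA k (Finset.mem_compl.1 hk)))

theorem gw_mul_gw_sub_mem (hanti : ∀ S T, a S * a T = -(a T * a S))
    (hsq : ∀ S, a S * a S = 0) (ζ : Fin 5 → F) (lam : F) :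
    gw ζ a lam 1 0 1 2 3 * gw ζ a lam (-1) 0 1 2 4 -
        ((ζ 0 - ζ 3) * (-1 * lam * cc ζ 0 1 2 4)) •
          (([{0, 1, 3}, {0, 2, 3}, {0, 1, 2}, {0, 1, 4}, {0, 2, 4}, {1, 2, 4}].map a).prod) ∈
      otherMonomials F a (insert {0, 1, 2}
        {{0, 1, 3}, {0, 1, 4}, {0, 2, 3}, {0, 2, 4}, {1, 2, 4}}) := by
  have h := sum_sub_sum_mem_otherMonomials (F := F) hanti hsq
    (A := insert {0, 1, 2} {{0, 1, 3}, {0, 1, 4}, {0, 2, 3}, {0, 2, 4}, {1, 2, 4}})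
    {((2, 6) : Fin 7 × Fin 7)}
    (fun k => weightCoeff ζ lam 1 0 1 2 3 k.1 * weightCoeff ζ lam (-1) 0 1 2 4 k.2)
    (fun k => weightWord 0 1 2 3 k.1 ++ weightWord 0 1 2 4 k.2)
    (by decide +kernel) (by decide +kernel)
  rw [Finset.sum_singleton, Fintype.sum_prod_type] at h
  rw [gw_eq_sum, gw_eq_sum, Finset.sum_mul_sum]
  simp only [smul_mul_smul_comm, ← List.prod_append, ← List.map_append]
  exact h

theorem gw_mul_gw_mul_gw_sub_mem (hanti : ∀ S T, a S * a T = -(a T * a S))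
    (hsq : ∀ S, a S * a S = 0) (ζ : Fin 5 → F) (lam : F) :
    gw ζ a lam (-1) 0 1 3 4 * gw ζ a lam (-1) 1 2 3 4 * gw ζ a lam 1 0 2 3 4 -
        (((ζ 0 - ζ 1) * (ζ 1 - ζ 4) * (1 * lam * cc ζ 0 2 3 4)) •
          (([{0, 1, 3}, {0, 1, 4}, {1, 2, 4}, {1, 3, 4},
            {0, 2, 3}, {0, 2, 4}, {0, 3, 4}, {2, 3, 4}].map a).prod) +
        (-1 * lam * cc ζ 0 1 3 4 * -(ζ 2 - ζ 4) * (ζ 0 - ζ 2)) •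
          (([{0, 1, 3}, {0, 1, 4}, {0, 3, 4}, {1, 3, 4},
            {1, 2, 4}, {2, 3, 4}, {0, 2, 3}, {0, 2, 4}].map a).prod)) ∈
      otherMonomials F a (insert {2, 3, 4} (insert {1, 3, 4} (insert {0, 3, 4}
        {{0, 1, 3}, {0, 1, 4}, {0, 2, 3}, {0, 2, 4}, {1, 2, 4}}))) := by
  have h := sum_sub_sum_mem_otherMonomials (F := F) hanti hsq
    (A := insert {2, 3, 4} (insert {1, 3, 4} (insert {0, 3, 4}
        {{0, 1, 3}, {0, 1, 4}, {0, 2, 3}, {0, 2, 4}, {1, 2, 4}})))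
    {(((0, 2), 6) : (Fin 7 × Fin 7) × Fin 7), ((6, 4), 0)}
    (fun k => weightCoeff ζ lam (-1) 0 1 3 4 k.1.1 * weightCoeff ζ lam (-1) 1 2 3 4 k.1.2 *
      weightCoeff ζ lam 1 0 2 3 4 k.2)
    (fun k => weightWord 0 1 3 4 k.1.1 ++ weightWord 1 2 3 4 k.1.2 ++ weightWord 0 2 3 4 k.2)
    (by decide +kernel) (by decide +kernel)
  rw [Finset.sum_pair (by decide), Fintype.sum_prod_type_right] at h
  simp only [Fintype.sum_prod_type] at h
  rw [gw_eq_sum, gw_eq_sum, gw_eq_sum, Finset.sum_mul_sum]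
  simp only [smul_mul_smul_comm, ← List.prod_append, ← List.map_append, Finset.sum_mul,
    Finset.mul_sum]
  exact h

end Weights

/-- Expanding `L = ∫ g₁₂₃₄ g₁₂₃₅ da₁₂₃` and
`R = −(1/ζ₄₅) ∭ g₁₂₄₅ g₂₃₄₅ g₁₃₄₅ da₃₄₅ da₂₄₅ da₁₄₅` as `F`-linear combinations of
ordered monomials in the generators `a S`, the coefficients of the degree-5 monomial
`a₁₂₄ a₁₂₅ a₁₃₄ a₁₃₅ a₂₃₅` in `L` and in `R` are equal.  Equivalently (the monomials
being a basis): `L − R` lies in the span of the monomials on sets of faces other than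
`{124, 125, 134, 135, 235}`. -/
theorem g_coefficient_check
    {F : Type*} [Field F] {Λ : Type*} [Ring Λ] [Algebra F Λ]
    (hchar : (2 : F) ≠ 0)
    (ζ : Fin 5 → F)
    (h45 : ζ 3 ≠ ζ 4) (lam : F)
    (a : Finset (Fin 5) → Λ)
    (hanti : ∀ S T, a S * a T = -(a T * a S))
    (hsq : ∀ S, a S * a S = 0)
    (B123 B145 B245 B345 : Λ →ₗ[F] Λ)
    (hB123 : IsBerezin F a ({0, 1, 2} : Finset (Fin 5)) B123)
    (hB145 : IsBerezin F a ({0, 3, 4} : Finset (Fin 5)) B145)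
    (hB245 : IsBerezin F a ({1, 3, 4} : Finset (Fin 5)) B245)
    (hB345 : IsBerezin F a ({2, 3, 4} : Finset (Fin 5)) B345)
 :
    B123 (gw ζ a lam 1 0 1 2 3 * gw ζ a lam (-1) 0 1 2 4) -
        (-(ζ 3 - ζ 4)⁻¹ •
          B145 (B245 (B345
            (gw ζ a lam (-1) 0 1 3 4 * gw ζ a lam (-1) 1 2 3 4 * gw ζ a lam 1 0 2 3 4)))) ∈
      Submodule.span F
        { x : Λ | ∃ l : List (Finset (Fin 5)),
            l.Nodup ∧ (∀ S ∈ l, S.card = 3) ∧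
            l.toFinset ≠
              ({{0, 1, 3}, {0, 1, 4}, {0, 2, 3}, {0, 2, 4}, {1, 2, 4}} :
                Finset (Finset (Fin 5))) ∧
            x = (l.map a).prod } := by
  change _ ∈ otherMonomials F a _
  have hL := hB123.map_mem_otherMonomials hanti (gw_mul_gw_sub_mem hanti hsq ζ lam)
  have hR := Submodule.smul_mem _ (ζ 3 - ζ 4)⁻¹ <| hB145.map_mem_otherMonomials hanti <|
    hB245.map_mem_otherMonomials hanti <|
    hB345.map_mem_otherMonomials hanti (gw_mul_gw_mul_gw_sub_mem hanti hsq ζ lam)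
  have l1 := hB123.map_word hanti (l₁ := [{0, 1, 3}, {0, 2, 3}])
    (l₂ := [{0, 1, 4}, {0, 2, 4}, {1, 2, 4}]) (by decide) (by decide)
  have l2 := word_move_right (F := F) hanti {0, 2, 3} [{0, 1, 3}] [{0, 1, 4}]
    [{0, 2, 4}, {1, 2, 4}]
  have r1 := hB345.map_word hanti (l₁ := [{0, 1, 3}, {0, 1, 4}, {1, 2, 4}, {1, 3, 4},
    {0, 2, 3}, {0, 2, 4}, {0, 3, 4}]) (l₂ := []) (by decide) (by decide)
  have r2 := hB245.map_word hanti (l₁ := [{0, 1, 3}, {0, 1, 4}, {1, 2, 4}])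
    (l₂ := [{0, 2, 3}, {0, 2, 4}, {0, 3, 4}]) (by decide) (by decide)
  have r3 := hB145.map_word hanti (l₁ := [{0, 1, 3}, {0, 1, 4}, {1, 2, 4}, {0, 2, 3}, {0, 2, 4}])
    (l₂ := []) (by decide) (by decide)
  have r4 := word_move_right (F := F) hanti {1, 2, 4} [{0, 1, 3}, {0, 1, 4}]
    [{0, 2, 3}, {0, 2, 4}] []
  have s1 := hB345.map_word hanti (l₁ := [{0, 1, 3}, {0, 1, 4}, {0, 3, 4}, {1, 3, 4}, {1, 2, 4}])
    (l₂ := [{0, 2, 3}, {0, 2, 4}]) (by decide) (by decide)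
  have s2 := hB245.map_word hanti (l₁ := [{0, 1, 3}, {0, 1, 4}, {0, 3, 4}])
    (l₂ := [{1, 2, 4}, {0, 2, 3}, {0, 2, 4}]) (by decide) (by decide)
  have s3 := hB145.map_word hanti (l₁ := [{0, 1, 3}, {0, 1, 4}])
    (l₂ := [{1, 2, 4}, {0, 2, 3}, {0, 2, 4}]) (by decide) (by decide)
  simp only [List.cons_append, List.nil_append, List.length_cons, List.length_nil]
    at l1 l2 r1 r2 r3 r4 s1 s2 s3
  simp only [map_sub, map_smul, l1, l2] at hL
  simp only [map_sub, map_add, map_smul, r1, r2, r3, r4, s1, s2, s3] at hR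
  have hz : ζ 3 - ζ 4 ≠ 0 := sub_ne_zero.2 h45
  convert add_mem hL hR using 1
  rw [neg_smul, sub_neg_eq_add, smul_sub, sub_add_sub_comm, eq_comm, sub_eq_self]
  simp only [smul_smul, ← add_smul]
  convert zero_smul F _
  simp only [cc]
  field_simp
  ring
end
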